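/- Let H ∈ (0,1/2) and 0 < T ≤ Δ. Then ∫_0^T ( (T−s+Δ)^{H+1/2} − (T−s)^{H+1/2} )² ds = ( (T+Δ)^{2H+2} − Δ^{2H+2} + T^{2H+2} )/(2H+2) − ( 2·T^{H+3/2}·Δ^{H+1/2}/(H+3/2) ) · ₂F₁( −(H+1/2), H+3/2; H+5/2; −T/Δ ). -/

import Mathlib

/-- The Gauss hypergeometric function `₂F₁(a,b;c;z)`, defined by its power series
`∑ (a)_n (b)_n / (c)_n · zⁿ/n!` with `(x)_n` the rising factorial (Pochhammer symbol). -/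
noncomputable def hyp2F1 (a b c z : ℝ) : ℝ :=
  ∑' n : ℕ, ((ascPochhammer ℝ n).eval a * (ascPochhammer ℝ n).eval b /
    (ascPochhammer ℝ n).eval c) * z ^ n / (n.factorial : ℝ)

open Polynomial in
/-- The binomial series `(1 - x) ^ (-b) = ∑ (b)_n / n! * xⁿ` for `|x| < 1`. -/
theorem hasSum_ascPochhammer_div_factorial_mul_pow (b : ℝ) {x : ℝ} (hx : |x| < 1) :
    HasSum (fun n : ℕ ↦ (ascPochhammer ℝ n).eval b / n.factorial * x ^ n) ((1 - x) ^ (-b)) := by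
  have hmem : x ∈ Metric.eball (0 : ℝ) 1 := by
    rw [← ENNReal.ofReal_one, Metric.eball_ofReal]
    simpa using hx
  have h := (Real.one_div_one_sub_rpow_hasFPowerSeriesOnBall_zero b).hasSum hmem
  have hcoeff (n : ℕ) :
      Ring.choose (b + n - 1) n = (ascPochhammer ℝ n).eval b / n.factorial := by
    rw [← Ring.multichoose_eq, eq_div_iff (by positivity), mul_comm, ← nsmul_eq_mul,
      Ring.factorial_nsmul_multichoose_eq_ascPochhammer, ascPochhammer_smeval_eq_eval]
  rw [Real.rpow_neg (by linarith [(abs_lt.mp hx).2])]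
  simpa [FormalMultilinearSeries.ofScalars, hcoeff] using h

theorem ascPochhammer_eval_neg_succ (a : ℝ) (n : ℕ) :
    (ascPochhammer ℝ (n + 1)).eval (-a) = -a * (ascPochhammer ℝ n).eval (1 - a) := by
  rw [ascPochhammer_succ_left]
  simp [neg_add_eq_sub]

theorem sum_ascPochhammer_eval_neg_div_factorial (a : ℝ) (n : ℕ) :
    ∑ k ∈ Finset.range (n + 1), (ascPochhammer ℝ k).eval (-a) / k.factorial =
      (ascPochhammer ℝ n).eval (1 - a) / n.factorial := by
  induction n with
  | zero => simp
  | succ n ih =>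
    rw [Finset.sum_range_succ, ih, ascPochhammer_eval_neg_succ, ascPochhammer_succ_eval,
      Nat.factorial_succ]
    push_cast
    field_simp
    ring

/-- The binomial series of exponent `a ∈ (0, 1)` converges absolutely on the closed unit disc. -/
theorem summable_abs_ascPochhammer_eval_neg_div_factorial {a : ℝ} (ha₀ : 0 < a) (ha₁ : a < 1) :
    Summable (fun n : ℕ ↦ |(ascPochhammer ℝ n).eval (-a) / n.factorial|) := by
  have hpos (n : ℕ) : 0 < (ascPochhammer ℝ n).eval (1 - a) :=
    ascPochhammer_pos n _ (by linarith)
  have habs (n : ℕ) : |(ascPochhammer ℝ (n + 1)).eval (-a) / (n + 1).factorial| =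
      -((ascPochhammer ℝ (n + 1)).eval (-a) / (n + 1).factorial) := by
    apply abs_of_nonpos
    rw [ascPochhammer_eval_neg_succ]
    exact div_nonpos_of_nonpos_of_nonneg
      (mul_nonpos_of_nonpos_of_nonneg (by linarith) (hpos n).le) (by positivity)
  rw [← summable_nat_add_iff 1]
  refine summable_of_sum_range_le (c := 1) (fun n ↦ abs_nonneg _) fun n ↦ ?_
  have hsum := sum_ascPochhammer_eval_neg_div_factorial a n
  rw [Finset.sum_range_succ'] at hsum
  have : 0 ≤ (ascPochhammer ℝ n).eval (1 - a) / n.factorial :=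
    div_nonneg (hpos n).le (by positivity)
  simp only [habs, Finset.sum_neg_distrib]
  simp only [ascPochhammer_zero, Polynomial.eval_one, Nat.factorial_zero, Nat.cast_one,
    div_one] at hsum
  linarith

theorem ascPochhammer_eval_div_eval_add_one {b : ℝ} (hb : 0 < b) (n : ℕ) :
    (ascPochhammer ℝ n).eval b / (ascPochhammer ℝ n).eval (b + 1) = b / (b + n) := by
  have h : b * (ascPochhammer ℝ n).eval (b + 1) = (ascPochhammer ℝ n).eval b * (b + n) := by
    rw [← ascPochhammer_succ_eval, ascPochhammer_succ_left]
    simp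
  have hpos := ascPochhammer_pos n (b + 1) (by linarith)
  rw [div_eq_div_iff hpos.ne' (by positivity), h]

/-- Euler-type integral: `∫₀ᵀ uᵃ (u + Δ)ᵃ du` as a hypergeometric value. -/
theorem integral_rpow_mul_add_rpow {a T Δ : ℝ} (ha₀ : 0 < a) (ha₁ : a < 1) (hT : 0 < T)
    (hTΔ : T ≤ Δ) :
    ∫ u in (0 : ℝ)..T, u ^ a * (u + Δ) ^ a =
      T ^ (a + 1) * Δ ^ a / (a + 1) * hyp2F1 (-a) (a + 1) (a + 2) (-T / Δ) := by
  have hΔ : 0 < Δ := hT.trans_le hTΔ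
  let c : ℕ → ℝ := fun n ↦ (ascPochhammer ℝ n).eval (-a) / n.factorial
  have hcont : Continuous fun u : ℝ ↦ u ^ a := Real.continuous_rpow_const ha₀.le
  have hsum := intervalIntegral.hasSum_integral_of_dominated_convergence
    (μ := MeasureTheory.volume) (a := 0) (b := T)
    (F := fun n u ↦ u ^ a * Δ ^ a * (c n * (-(u / Δ)) ^ n))
    (f := fun u ↦ u ^ a * (u + Δ) ^ a)
    (fun n u ↦ u ^ a * Δ ^ a * |c n|)
    (fun n ↦ by
      apply Continuous.aestronglyMeasurable
      fun_prop)
    (fun n ↦ by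
      refine Filter.Eventually.of_forall fun u hu ↦ ?_
      rw [Set.uIoc_of_le hT.le] at hu
      have hu₀ := hu.1
      have hle : u / Δ ≤ 1 := (div_le_one hΔ).mpr (hu.2.trans hTΔ)
      rw [Real.norm_eq_abs, abs_mul, abs_mul (c n), abs_pow, abs_neg,
        abs_of_nonneg (by positivity : 0 ≤ u ^ a * Δ ^ a), abs_of_nonneg (by positivity : 0 ≤ u / Δ)]
      gcongr
      exact mul_le_of_le_one_right (abs_nonneg _) (pow_le_one₀ (by positivity) hle))
    (Filter.Eventually.of_forall fun u _ ↦
      (summable_abs_ascPochhammer_eval_neg_div_factorial ha₀ ha₁).mul_left _)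
    (by
      simp_rw [tsum_mul_left]
      apply Continuous.intervalIntegrable
      fun_prop)
    (by
      filter_upwards [MeasureTheory.volume.ae_ne T] with u hne hu
      rw [Set.uIoc_of_le hT.le] at hu
      have hu₀ := hu.1
      have hlt : u / Δ < 1 := (div_lt_one hΔ).mpr ((hu.2.lt_of_ne hne).trans_le hTΔ)
      have h := hasSum_ascPochhammer_div_factorial_mul_pow (-a) (x := -(u / Δ))
        (by rwa [abs_neg, abs_of_pos (by positivity)])
      have hval : u ^ a * Δ ^ a * (1 - -(u / Δ)) ^ (- -a) = u ^ a * (u + Δ) ^ a := by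
        rw [neg_neg, mul_assoc, ← Real.mul_rpow hΔ.le (by rw [sub_neg_eq_add]; positivity)]
        congr 2
        field_simp
        ring
      exact hval ▸ h.mul_left (u ^ a * Δ ^ a))
  have hterm (n : ℕ) : ∫ u in (0 : ℝ)..T, u ^ a * Δ ^ a * (c n * (-(u / Δ)) ^ n) =
      T ^ (a + 1) * Δ ^ a / (a + 1) * (((ascPochhammer ℝ n).eval (-a) *
        (ascPochhammer ℝ n).eval (a + 1) / (ascPochhammer ℝ n).eval (a + 2)) *
          (-T / Δ) ^ n / n.factorial) := by
    have hcongr : ∫ u in (0 : ℝ)..T, u ^ a * Δ ^ a * (c n * (-(u / Δ)) ^ n) =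
        ∫ u in (0 : ℝ)..T, Δ ^ a * c n * (-1 / Δ) ^ n * u ^ (a + n) := by
      refine intervalIntegral.integral_congr_ae (Filter.Eventually.of_forall fun u hu ↦ ?_)
      rw [Set.uIoc_of_le hT.le] at hu
      rw [Real.rpow_add hu.1, Real.rpow_natCast, show -(u / Δ) = -1 / Δ * u by ring, mul_pow]
      ring
    have hn : (0 : ℝ) ≤ n := n.cast_nonneg
    rw [hcongr, intervalIntegral.integral_const_mul, integral_rpow (Or.inl (by linarith)),
      Real.zero_rpow (by linarith), mul_div_assoc (Polynomial.eval (-a) _),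
      show a + 2 = a + 1 + 1 by ring, ascPochhammer_eval_div_eval_add_one (by linarith),
      show a + n + 1 = a + 1 + n by ring, Real.rpow_add hT, Real.rpow_natCast,
      show -T / Δ = -1 / Δ * T by ring, mul_pow]
    simp only [c]
    field_simp
    ring
  simp_rw [hterm] at hsum
  rw [← hsum.tsum_eq, tsum_mul_left, hyp2F1]

/-- Closed form of the variance integral of the Bayer–Friz–Gatheral log-normal
approximation:
`∫₀ᵀ ((T-s+Δ)^{H+1/2} − (T-s)^{H+1/2})² ds
 = ((T+Δ)^{2H+2} − Δ^{2H+2} + T^{2H+2})/(2H+2)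
   − (2 T^{H+3/2} Δ^{H+1/2}/(H+3/2)) ₂F₁(−(H+1/2), H+3/2; H+5/2; −T/Δ)`. -/
theorem stmt16 (H T Δ : ℝ) (hH : H ∈ Set.Ioo (0:ℝ) (1/2)) (hT : 0 < T) (hTΔ : T ≤ Δ) :
    ∫ s in (0:ℝ)..T, ((T - s + Δ) ^ (H + 1/2) - (T - s) ^ (H + 1/2))^2 =
      ((T + Δ) ^ (2*H + 2) - Δ ^ (2*H + 2) + T ^ (2*H + 2)) / (2*H + 2)
        - (2 * T ^ (H + 3/2) * Δ ^ (H + 1/2) / (H + 3/2)) *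
            hyp2F1 (-(H + 1/2)) (H + 3/2) (H + 5/2) (-T / Δ) := by
  obtain ⟨hH₀, hH₁⟩ := hH
  have hΔ : 0 < Δ := hT.trans_le hTΔ
  have hcont : Continuous fun u : ℝ ↦ u ^ (H + 1/2) :=
    Real.continuous_rpow_const (by linarith)
  have hcont' : Continuous fun u : ℝ ↦ u ^ (2*H + 1) :=
    Real.continuous_rpow_const (by linarith)
  have hsq {x : ℝ} (hx : 0 ≤ x) : (x ^ (H + 1/2)) ^ 2 = x ^ (2*H + 1) := by
    rw [← Real.rpow_mul_natCast hx]
    congr 1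
    push_cast
    ring
  have hexpand : ∫ u in (0:ℝ)..T, ((u + Δ) ^ (H + 1/2) - u ^ (H + 1/2)) ^ 2 =
      ∫ u in (0:ℝ)..T, ((u + Δ) ^ (2*H + 1) + u ^ (2*H + 1)
        - 2 * (u ^ (H + 1/2) * (u + Δ) ^ (H + 1/2))) := by
    refine intervalIntegral.integral_congr fun u hu ↦ ?_
    rw [Set.uIcc_of_le hT.le] at hu
    simp only [← hsq hu.1, ← hsq (add_nonneg hu.1 hΔ.le)]
    ring
  have hshift : Continuous fun u : ℝ ↦ (u + Δ) ^ (2*H + 1) :=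
    hcont'.comp (continuous_add_const Δ)
  have hprod : Continuous fun u : ℝ ↦ 2 * (u ^ (H + 1/2) * (u + Δ) ^ (H + 1/2)) :=
    continuous_const.mul (hcont.mul (hcont.comp (continuous_add_const Δ)))
  have hadd : Continuous fun u : ℝ ↦ (u + Δ) ^ (2*H + 1) + u ^ (2*H + 1) := hshift.add hcont'
  rw [intervalIntegral.integral_comp_sub_left
      (fun u ↦ ((u + Δ) ^ (H + 1/2) - u ^ (H + 1/2)) ^ 2) T, sub_self, sub_zero, hexpand,
    intervalIntegral.integral_sub (hadd.intervalIntegrable 0 T)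
      (hprod.intervalIntegrable 0 T),
    intervalIntegral.integral_add (hshift.intervalIntegrable 0 T)
      (hcont'.intervalIntegrable 0 T),
    intervalIntegral.integral_const_mul,
    integral_rpow_mul_add_rpow (by linarith) (by linarith) hT hTΔ,
    intervalIntegral.integral_comp_add_right (fun u ↦ u ^ (2*H + 1)) Δ,
    integral_rpow (Or.inl (by linarith)), integral_rpow (Or.inl (by linarith)),
    Real.zero_rpow (by linarith), zero_add, show 2*H + 1 + 1 = 2*H + 2 by ring,
    show H + 1/2 + 1 = H + 3/2 by ring, show H + 1/2 + 2 = H + 5/2 by ring]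
  ring
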